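/- arXiv:1707.03894 — 2 statements merged into one kernel-verified Lean document; each statement's English description precedes it below -/
import Mathlib

section
/- The set of integers b ≥ 2 for which there exist positive integers y and c with b ≤ c < b² and y³ = c·(b² + 1) is infinite. -/
theorem pell_aux (n : ℕ) : ∃ b f : ℕ, n < b ∧ 7 ≤ b ∧ f ≤ b ∧ b ≤ 4 * f ∧ b ^ 2 + 1 = 2 * f ^ 2 := by
  induction n with
  | zero => exact ⟨7, 5, by norm_num⟩
  | succ n ih =>
    obtain ⟨b, f, h1, h2, h3, h4, h5⟩ := ih
    refine ⟨3 * b + 4 * f, 2 * b + 3 * f, by omega, by omega, by omega, by omega, ?_⟩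
    nlinarith

theorem infinitely_many_bases_322 :
    {b : ℕ | 2 ≤ b ∧ ∃ y c : ℕ, 0 < y ∧ 0 < c ∧ b ≤ c ∧ c < b ^ 2 ∧
      y ^ 3 = c * (b ^ 2 + 1)}.Infinite := by
  refine Set.infinite_of_forall_exists_gt fun n => ?_
  obtain ⟨b, f, h1, h2, h3, h4, h5⟩ := pell_aux n
  refine ⟨b, ⟨by omega, 2 * f, 4 * f, by omega, by omega, h4, by nlinarith, ?_⟩, h1⟩
  rw [h5]; ring
end

section
/- The set of integers b ≥ 2 for which there exist positive integers y and c with b² ≤ c < b³ and y³ = c·(b³ + 1) is infinite. -/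
lemma pell_aux_s14 (N : ℕ) : ∃ m s : ℕ, N ≤ m ∧ 7 ≤ m ∧ s ^ 2 = 3 * m ^ 2 + 3 * m + 1 := by
  induction N with
  | zero => exact ⟨7, 13, by norm_num, by norm_num, by norm_num⟩
  | succ k ih =>
    obtain ⟨m, s, h1, h2, h3⟩ := ih
    refine ⟨7 * m + 3 + 4 * s, 7 * s + 12 * m + 6, by omega, by omega, ?_⟩
    zify at h3 ⊢
    linear_combination h3

theorem infinitely_many_bases_323 :
    {b : ℕ | 2 ≤ b ∧ ∃ y c : ℕ, 0 < y ∧ 0 < c ∧ b ^ 2 ≤ c ∧ c < b ^ 3 ∧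
      y ^ 3 = c * (b ^ 3 + 1)}.Infinite := by
  apply Set.infinite_of_forall_exists_gt
  intro N
  obtain ⟨m, s, h1, h2, h3⟩ := pell_aux_s14 N
  have hs1 : m < s := by nlinarith
  have hs2 : s ≤ 2 * m := by nlinarith
  refine ⟨3 * m + 2, ⟨by omega, 3 * (m + 1) * s, 3 * (m + 1) ^ 2 * s, ?_, ?_, ?_, ?_, ?_⟩, by omega⟩
  · have : 0 < s := by omega
    positivity
  · have : 0 < s := by omega
    positivity
  · have : 3 * (m + 1) ^ 2 * 3 ≤ 3 * (m + 1) ^ 2 * s := Nat.mul_le_mul_left _ (by omega)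
    nlinarith
  · have : 3 * (m + 1) ^ 2 * s ≤ 3 * (m + 1) ^ 2 * (2 * m) := Nat.mul_le_mul_left _ hs2
    refine lt_of_le_of_lt this ?_
    ring_nf
    have : 0 ≤ m ^ 3 := by positivity
    nlinarith
  · have : (3 * m + 2) ^ 3 + 1 = 9 * (m + 1) * s ^ 2 := by rw [h3]; ring
    rw [this]; ring
end
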